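/- A nonzero f ∈ I is s-top-irreducible with respect to s(f) if and only if s(f) = Ω(LM_h(f)). -/

import Mathlib

open MvPolynomial

noncomputable section

namespace TropF5

/-- Variable index type: `none` is the homogenizing variable `h`,
`some (.inl i)` is `x i`, `some (.inr i)` is `∂ i` (resp. `ξ i`). -/
abbrev Vars (n : ℕ) := Option (Fin n ⊕ Fin n)

/-- The commutative polynomial ring `K[h, x, ξ]`. -/
abbrev Poly (n : ℕ) (K : Type*) [Field K] := MvPolynomial (Vars n) K

/-- Monomials (exponent vectors) of `K[h,x,ξ]`. -/
abbrev Mon (n : ℕ) := Vars n →₀ ℕ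

/-- Module monomials `h^γ x^α ξ^β e_i` of `K[h,x,ξ]^N`. -/
abbrev MMon (n N : ℕ) := Mon n × Fin N

/-- Total degree of a monomial. -/
def mdeg {n : ℕ} (d : Mon n) : ℕ := d.sum fun _ k => k

/-- The weight `w·(α,β)` of the `(x,ξ)`-part of a monomial. -/
def wdeg {n : ℕ} (w : Fin n ⊕ Fin n → ℝ) (d : Mon n) : ℝ :=
  ∑ j : Fin n ⊕ Fin n, w j * (d (some j) : ℝ)

/-- The `(x,ξ)`-part `x^α ξ^β` of a monomial `h^γ x^α ξ^β`. -/
def xiPart {n : ℕ} (d : Mon n) : (Fin n ⊕ Fin n) →₀ ℕ :=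
  Finsupp.equivFunOnFinite.symm fun j => d (some j)

/-- The data defining a tropical term order on `K[h,x,ξ]`: a valuation on `K`,
weight vectors `w, ω ∈ ℝ^{2n}`, and a monomial order `prec` used as tie-breaker. -/
structure OrdData (n : ℕ) (K : Type*) [Field K] where
  val : K → ℝ
  val_mul : ∀ a b : K, a ≠ 0 → b ≠ 0 → val (a * b) = val a + val b
  val_add : ∀ a b : K, a ≠ 0 → b ≠ 0 → a + b ≠ 0 → min (val a) (val b) ≤ val (a + b)
  w : Fin n ⊕ Fin n → ℝ
  om : Fin n ⊕ Fin n → ℝ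
  w_nonneg : ∀ i : Fin n, 0 ≤ w (Sum.inl i)
  w_big : ∀ i j : Fin n, w (Sum.inl j) < w (Sum.inr i)
  prec : LinearOrder ((Fin n ⊕ Fin n) →₀ ℕ)
  prec_add : ∀ u v t : (Fin n ⊕ Fin n) →₀ ℕ, prec.lt u v → prec.lt (u + t) (v + t)
  prec_zero_le : ∀ u, prec.le 0 u

variable {n N : ℕ} {K : Type*} [Field K]

/-- The strict tropical term order `<_h` on terms `a·d`, `b·e` of `K[h,x,ξ]`:
first by total degree, then by `w`-weight, then by valuation-adjusted `ω`-weight,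
and finally by the tie-breaking monomial order on the `(x,ξ)`-parts. -/
def ltTerm (D : OrdData n K) (a : K) (d : Mon n) (b : K) (e : Mon n) : Prop :=
  mdeg d < mdeg e ∨ (mdeg d = mdeg e ∧
    (wdeg D.w d < wdeg D.w e ∨ (wdeg D.w d = wdeg D.w e ∧
      (-D.val a + wdeg D.om d < -D.val b + wdeg D.om e ∨
        (-D.val a + wdeg D.om d = -D.val b + wdeg D.om e ∧
          D.prec.lt (xiPart d) (xiPart e))))))

/-- `d` is the `≤_h`-leading monomial of the polynomial `p`. -/
def IsLM (D : OrdData n K) (p : Poly n K) (d : Mon n) : Prop :=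
  d ∈ p.support ∧ ∀ e ∈ p.support, e ≠ d → ltTerm D (p.coeff e) e (p.coeff d) d

open Classical in
/-- The `≤_h`-leading monomial of a polynomial (junk value `0` if there is none). -/
def LM (D : OrdData n K) (p : Poly n K) : Mon n :=
  if h : ∃ d, IsLM D p d then h.choose else 0

/-- The module element `σ e_i` of `K[h,x,ξ]^N` corresponding to a module monomial. -/
def msingle {N : ℕ} (m : MMon n N) : Fin N → Poly n K := Pi.single m.2 (monomial m.1 1)

/-- Product of a monomial with a module monomial. -/
def mulM {N : ℕ} (d : Mon n) (m : MMon n N) : MMon n N := (d + m.1, m.2)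

/-- An abstract setting for the homogenized Weyl algebra `R = D_n^{(h)}(K)`:
a `K`-algebra `R` with generators `h, x_i, ∂_i` satisfying the Weyl relations,
the total-symbol `K`-linear isomorphism `Ψ_h : R ≃ K[h,x,ξ]` sending normally
ordered monomials to monomials, a tropical order datum, and a generating family
`F` of homogeneous elements. -/
structure Setting (n N : ℕ) (K : Type*) [Field K] (R : Type*) [Ring R] [Algebra K R] where
  D : OrdData n K
  /-- the generators: `Xg none = h`, `Xg (some (.inl i)) = x i`, `Xg (some (.inr i)) = ∂ i` -/
  Xg : Vars n → R
  h_comm : ∀ v, Xg none * Xg v = Xg v * Xg none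
  x_comm : ∀ i j : Fin n,
    Xg (some (Sum.inl i)) * Xg (some (Sum.inl j)) = Xg (some (Sum.inl j)) * Xg (some (Sum.inl i))
  d_comm : ∀ i j : Fin n,
    Xg (some (Sum.inr i)) * Xg (some (Sum.inr j)) = Xg (some (Sum.inr j)) * Xg (some (Sum.inr i))
  dx_comm : ∀ i j : Fin n, i ≠ j →
    Xg (some (Sum.inr i)) * Xg (some (Sum.inl j)) = Xg (some (Sum.inl j)) * Xg (some (Sum.inr i))
  dx_h : ∀ i : Fin n,
    Xg (some (Sum.inr i)) * Xg (some (Sum.inl i))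
      = Xg (some (Sum.inl i)) * Xg (some (Sum.inr i)) + Xg none ^ 2
  /-- the total symbol map `Ψ_h` -/
  Psi : R ≃ₗ[K] Poly n K
  Psi_monomial : ∀ d : Mon n,
    Psi (Xg none ^ d none *
      ((List.ofFn fun i : Fin n => Xg (some (Sum.inl i)) ^ d (some (Sum.inl i))).prod *
       (List.ofFn fun i : Fin n => Xg (some (Sum.inr i)) ^ d (some (Sum.inr i))).prod)) =
    monomial d 1
  /-- the generating set `F = {f_1, …, f_N}` -/
  F : Fin N → R
  F_hom : ∀ i, ∃ dF : ℕ, (Psi (F i)).IsHomogeneous dF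

namespace Setting

variable {R : Type*} [Ring R] [Algebra K R] [NeZero N] (S : Setting n N K R)

/-- `ν : R^N → I`, `ν(a) = Σ a_i f_i`. -/
def nu (g : Fin N → R) : R := ∑ i, g i * S.F i

/-- The left ideal `I` generated by `F`. -/
def idl : Submodule R R := Submodule.span R (Set.range S.F)

/-- The componentwise total symbol map `Φ : R^N → K[h,x,ξ]^N`. -/
def Phi (g : Fin N → R) : Fin N → Poly n K := fun i => S.Psi (g i)

/-- The inverse total symbol of a monomial: the monomial `h^γ x^α ∂^β` of `R`. -/
def monR (d : Mon n) : R := S.Psi.symm (monomial d 1)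

/-- `t` is a term (nonzero coefficient times a monomial) of `R`. -/
def IsTermR (t : R) : Prop := ∃ (d : Mon n) (c : K), c ≠ 0 ∧ S.Psi t = monomial d c

/-- `≤_h`-leading monomial of an element of `R` (via its total symbol). -/
def LMr (f : R) : Mon n := LM S.D (S.Psi f)

/-- `≤_h`-leading coefficient of an element of `R`. -/
def LCr (f : R) : K := (S.Psi f).coeff (S.LMr f)

/-- `LT_h f ≤_h LT_h g` (strictly smaller, or equal monomials and equal valuations). -/
def leLT (f g : R) : Prop :=
  ltTerm S.D (S.LCr f) (S.LMr f) (S.LCr g) (S.LMr g) ∨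
    (S.D.val (S.LCr f) = S.D.val (S.LCr g) ∧ S.LMr f = S.LMr g)


/-- `m` is the leading monomial of the syzygy `a`: writing `m = (d, i)`,
`i` is the largest index with `a i ≠ 0` and `d = LM_h (a i)`. -/
def IsSyzLM (m : MMon n N) : Prop :=
  ∃ a : Fin N → R, S.nu a = 0 ∧ a m.2 ≠ 0 ∧ (∀ j, m.2 < j → a j = 0) ∧
    IsLM S.D (S.Psi (a m.2)) m.1

/-- `LSyz(F)`: the `K[h,x,ξ]`-submodule generated by leading monomials of syzygies. -/
def LSyz : Submodule (Poly n K) (Fin N → Poly n K) :=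
  Submodule.span _ { v | ∃ m : MMon n N, S.IsSyzLM m ∧ v = msingle m }

/-- Membership of a module monomial in `LSyz(F)`. -/
def inLSyz (m : MMon n N) : Prop := msingle m ∈ S.LSyz

/-- The strict total order `<_sign` on module monomials. -/
def ltSign (m m' : MMon n N) : Prop :=
  m.2 < m'.2 ∨ (m.2 = m'.2 ∧ (mdeg m.1 < mdeg m'.1 ∨ (mdeg m.1 = mdeg m'.1 ∧
    (wdeg S.D.w m.1 < wdeg S.D.w m'.1 ∨ (wdeg S.D.w m.1 = wdeg S.D.w m'.1 ∧
      ((¬ S.inLSyz m ∧ S.inLSyz m') ∨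
        ((S.inLSyz m ↔ S.inLSyz m') ∧ S.D.prec.lt (xiPart m.1) (xiPart m'.1))))))))

/-- `m` is the `≤_sign`-largest module monomial of `Φ(g)`. -/
def IsLMsign (g : Fin N → R) (m : MMon n N) : Prop :=
  m.1 ∈ (S.Psi (g m.2)).support ∧
    ∀ m' : MMon n N, m'.1 ∈ (S.Psi (g m'.2)).support → m' ≠ m → S.ltSign m' m

open Classical in
/-- `LM_sign(g)` (junk value if there is none). -/
def LMsign (g : Fin N → R) : MMon n N :=
  if h : ∃ m, S.IsLMsign g m then h.choose else ((0 : Mon n), (0 : Fin N))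

/-- `m` is the signature of `f`: the `≤_sign`-minimum of
`{LM_sign(g) : ν(g) = f}`. -/
def IsSig (f : R) (m : MMon n N) : Prop :=
  (∃ g : Fin N → R, S.nu g = f ∧ S.IsLMsign g m) ∧
    ∀ (g : Fin N → R) (m' : MMon n N), S.nu g = f → S.IsLMsign g m' → ¬ S.ltSign m' m

open Classical in
/-- The signature `s(f)` of `f ∈ I \ {0}` (junk value if there is none). -/
def sig (f : R) : MMon n N :=
  if h : ∃ m, S.IsSig f m then h.choose else ((0 : Mon n), (0 : Fin N))


/-- A module element is clean if `ν(g) ≠ 0` and no module monomial of `Φ(g)`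
belongs to `LSyz(F)`. -/
def Clean (g : Fin N → R) : Prop :=
  S.nu g ≠ 0 ∧ ∀ m : MMon n N, m.1 ∈ (S.Psi (g m.2)).support → ¬ S.inLSyz m

/-- `f` is `s`-top-reducible with respect to the module monomial `m`:
some `g ∈ I \ {0}` and term `t` satisfy `LM_h(t g) = LM_h(f)` and `s(t g) <_sign m`. -/
def sTopRed (f : R) (m : MMon n N) : Prop :=
  ∃ g ∈ S.idl, g ≠ 0 ∧ ∃ t : R, S.IsTermR t ∧
    S.LMr (t * g) = S.LMr f ∧ S.ltSign (S.sig (t * g)) m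

/-- `f` is `s`-top-irreducible with respect to `m`. -/
def sTopIrr (f : R) (m : MMon n N) : Prop := f = 0 ∨ ¬ S.sTopRed f m

/-- `σ` is the value `Ω(m)`: the `≤_sign`-minimum of
`{s(f) : f ∈ I \ {0}, LM_h(f) = m}`. -/
def IsOmega (m : Mon n) (σ : MMon n N) : Prop :=
  (∃ f, f ∈ S.idl ∧ f ≠ 0 ∧ S.LMr f = m ∧ S.sig f = σ) ∧
    ∀ f, f ∈ S.idl → f ≠ 0 → S.LMr f = m → ¬ S.ltSign (S.sig f) σ

open Classical in
/-- The map `Ω` (junk value if the minimum does not exist). -/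
def Omega (m : Mon n) : MMon n N :=
  if h : ∃ σ, S.IsOmega m σ then h.choose else ((0 : Mon n), (0 : Fin N))

/-- `G` is an `s`-Gröbner basis of `I`. -/
def IsSGB (G : Set R) : Prop :=
  G.Nonempty ∧ Submodule.span R G = S.idl ∧
    ∀ f ∈ S.idl, f ≠ 0 → S.sTopIrr f (S.sig f) →
      ∃ g ∈ G, ∃ d : Mon n,
        S.LMr (S.monR d * g) = S.LMr f ∧ mulM d (S.sig g) = S.sig f

/-- `G` is a (tropical) Gröbner basis of `I`:
`RG = I` and `⟨LM_h(G)⟩ = ⟨LM_h(I)⟩`. -/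
def IsGB (G : Set R) : Prop :=
  G.Nonempty ∧ Submodule.span R G = S.idl ∧
    Ideal.span ((fun g => (monomial (S.LMr g) 1 : Poly n K)) '' {g | g ∈ G ∧ g ≠ 0}) =
      Ideal.span ((fun g => (monomial (S.LMr g) 1 : Poly n K)) '' {f | f ∈ S.idl ∧ f ≠ 0})

/-- `g` is primitive `s`-top-irreducible. -/
def Primitive (g : R) : Prop :=
  g ∈ S.idl ∧ g ≠ 0 ∧ S.sTopIrr g (S.sig g) ∧
    ¬ ∃ g', g' ∈ S.idl ∧ g' ≠ 0 ∧ S.sTopIrr g' (S.sig g') ∧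
      ∃ d : Mon n, d ≠ 0 ∧ S.LMr (S.monR d * g') = S.LMr g ∧
        S.sig (S.monR d * g') = S.sig g

/-- `f` is redundant to `G`. -/
def Redundant (f : R) (G : Set R) : Prop :=
  f ≠ 0 ∧ ∃ g ∈ G, ∃ (d : Mon n) (c : K), c ≠ 0 ∧
    f = S.Psi.symm (monomial d c) * g ∧ S.ltSign (S.sig f) (mulM d (S.sig g))

/-- The cofactor `u_1` of the S-pair of `(g_1, g_2)`. -/
def u1 (g1 g2 : R) : R :=
  S.Psi.symm (monomial ((S.LMr g1 ⊔ S.LMr g2) - S.LMr g1) (S.LCr g2))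

/-- The cofactor `u_2` of the S-pair of `(g_1, g_2)`. -/
def u2 (g1 g2 : R) : R :=
  S.Psi.symm (monomial ((S.LMr g1 ⊔ S.LMr g2) - S.LMr g2) (S.LCr g1))

/-- The S-pair `spair(g_1, g_2) = u_1 g_1 - u_2 g_2`. -/
def spair (g1 g2 : R) : R := S.u1 g1 g2 * g1 - S.u2 g1 g2 * g2

/-- `(g_1, g_2)` is a normal pair relative to `G`. -/
def NormalPair (G : Set R) (g1 g2 : R) : Prop :=
  S.Primitive g1 ∧ S.Primitive g2 ∧
    S.sig (S.u1 g1 g2 * g1) = mulM ((S.LMr g1 ⊔ S.LMr g2) - S.LMr g1) (S.sig g1) ∧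
    S.sig (S.u2 g1 g2 * g2) = mulM ((S.LMr g1 ⊔ S.LMr g2) - S.LMr g2) (S.sig g2) ∧
    S.sig (S.u1 g1 g2 * g1) ≠ S.sig (S.u2 g1 g2 * g2) ∧
    ¬ S.Redundant (S.spair g1 g2) G

end Setting

end TropF5

namespace TropF5

variable {n N : ℕ} {K R : Type*} [Field K] [Ring R] [Algebra K R]

lemma eq_of_mdeg_eq_of_xiPart_eq {d e : Mon n} (h : mdeg d = mdeg e)
    (hx : xiPart d = xiPart e) : d = e := by
  have hs : ∀ j, d (some j) = e (some j) := fun j => DFunLike.congr_fun hx j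
  ext v
  rcases v with _ | j
  · simp only [mdeg, Finsupp.sum_fintype, implies_true, Fintype.sum_option, hs] at h
    omega
  · exact hs j

lemma finite_mdeg_eq (k : ℕ) : {d : Mon n | mdeg d = k}.Finite :=
  (Finsupp.finite_of_degree_le k).subset fun _ hd => le_of_eq hd

lemma degreeOf_pderiv_le {σ A : Type*} [CommSemiring A] (i j : σ) (p : MvPolynomial σ A) :
    degreeOf j (pderiv i p) ≤ degreeOf j p := by
  rw [degreeOf_le_iff]
  intro m hm
  have hm' : m + Finsupp.single i 1 ∈ p.support := by
    rw [mem_support_iff] at hm ⊢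
    rw [coeff_pderiv] at hm
    exact fun h0 => hm (by rw [h0]; simp)
  refine le_trans ?_ (monomial_le_degreeOf j hm')
  simp

lemma exists_prod_ofFn_update_eq {M : Type*} [Monoid M] {m : ℕ} (a : Fin m → M) (i : Fin m) :
    ∃ A B : M, (∀ z, (∀ j, j ≠ i → Commute z (a j)) → Commute z A ∧ Commute z B) ∧
      ∀ y, (List.ofFn (Function.update a i y)).prod = A * y * B := by
  induction m with
  | zero => exact i.elim0
  | succ m ih =>
    refine Fin.cases ?_ (fun i => ?_) i
    · refine ⟨1, (List.ofFn fun j : Fin m => a j.succ).prod, fun z hz => ⟨.one_right z, ?_⟩, ?_⟩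
      · refine Commute.list_prod_right _ _ fun x hx => ?_
        obtain ⟨j, rfl⟩ := (List.mem_ofFn' _ _).1 hx
        exact hz _ (Fin.succ_ne_zero j)
      · intro y
        simp [List.ofFn_succ]
    · obtain ⟨A, B, hAB, h⟩ := ih (fun j => a j.succ) i
      refine ⟨a 0 * A, B, fun z hz => ?_, fun y => ?_⟩
      · obtain ⟨hA, hB⟩ := hAB z fun j hj => hz _ fun hji => hj (Fin.succ_injective _ hji)
        exact ⟨(hz 0 (Fin.succ_ne_zero i).symm).mul_right hA, hB⟩
      · have hu : (fun j : Fin m => Function.update a i.succ y j.succ) =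
            Function.update (fun j : Fin m => a j.succ) i y := by
          ext j
          by_cases hj : j = i
          · subst hj; simp
          · simp [hj]
        rw [List.ofFn_succ, List.prod_cons, hu, h,
          Function.update_of_ne (Fin.succ_ne_zero i).symm]
        simp only [mul_assoc]

namespace Setting

section SignatureOrder

variable (S : Setting n N K R)

lemma ltSign_irrefl (m : MMon n N) : ¬ S.ltSign m m := by
  intro h
  have := @lt_irrefl _ S.D.prec.toPreorder (xiPart m.1)
  simp only [ltSign, lt_irrefl, false_or, true_and, not_and_self, iff_self] at h
  exact this h

lemma ltSign_trans {a b c : MMon n N} (hab : S.ltSign a b) (hbc : S.ltSign b c) :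
    S.ltSign a c := by
  have : S.D.prec.lt (xiPart a.1) (xiPart b.1) → S.D.prec.lt (xiPart b.1) (xiPart c.1) →
      S.D.prec.lt (xiPart a.1) (xiPart c.1) := @lt_trans _ S.D.prec.toPreorder _ _ _
  simp only [ltSign] at *
  generalize S.D.prec.lt = r at *
  grind

lemma ltSign_of_ne {a b : MMon n N} (hne : a ≠ b) : S.ltSign a b ∨ S.ltSign b a := by
  have hpt : S.D.prec.lt (xiPart a.1) (xiPart b.1) ∨ xiPart a.1 = xiPart b.1 ∨
      S.D.prec.lt (xiPart b.1) (xiPart a.1) :=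
    @lt_trichotomy _ S.D.prec _ _
  have heq : a.2 = b.2 → mdeg a.1 = mdeg b.1 → xiPart a.1 ≠ xiPart b.1 := fun h₁ h₂ h₃ =>
    hne (Prod.ext (eq_of_mdeg_eq_of_xiPart_eq h₂ h₃) h₁)
  simp only [ltSign]
  generalize S.D.prec.lt = r at *
  grind

lemma exists_minimal_ltSign {s : Set (MMon n N)} (hs : s.Nonempty) :
    ∃ m ∈ s, ∀ m' ∈ s, ¬ S.ltSign m' m := by
  let key : MMon n N → Fin N ×ₗ ℕ := fun m => toLex (m.2, mdeg m.1)
  obtain ⟨m₀, hm₀, hmin⟩ : ∃ m ∈ s, ∀ m' ∈ s, ¬ key m' < key m :=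
    (InvImage.wf key wellFounded_lt).has_min s hs
  let T : Set (MMon n N) := {m | m ∈ s ∧ key m = key m₀}
  have hT : T.Finite := by
    refine ((finite_mdeg_eq (n := n) (mdeg m₀.1)).prod (Set.finite_univ (α := Fin N))).subset ?_
    rintro m ⟨-, hm⟩
    exact ⟨congrArg (fun p : Fin N ×ₗ ℕ => (ofLex p).2) hm, trivial⟩
  have : Finite T := hT
  let r : T → T → Prop := fun a b => S.ltSign a b
  have : IsTrans T r := ⟨fun _ _ _ => S.ltSign_trans⟩
  have : Std.Irrefl r := ⟨fun a => S.ltSign_irrefl a⟩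
  obtain ⟨⟨m, hm, hk⟩, -, hmm⟩ :=
    (Finite.wellFounded_of_trans_of_irrefl r).has_min Set.univ ⟨⟨m₀, hm₀, rfl⟩, trivial⟩
  refine ⟨m, hm, fun m' hm' hlt => ?_⟩
  have hle : key m' ≤ key m := by
    simp only [key, Prod.Lex.toLex_le_toLex]
    simp only [ltSign] at hlt
    grind
  rcases hle.lt_or_eq with h | h
  · exact hmin m' hm' (hk ▸ h)
  · exact hmm ⟨m', hm', h.trans hk⟩ trivial hlt

lemma isOmega_Omega [NeZero N] {f : R} (hf : f ∈ S.idl) (hf0 : f ≠ 0) :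
    S.IsOmega (S.LMr f) (S.Omega (S.LMr f)) := by
  have hex : ∃ σ, S.IsOmega (S.LMr f) σ := by
    obtain ⟨σ, hσ, hmin⟩ := S.exists_minimal_ltSign
      (s := {σ | ∃ g, g ∈ S.idl ∧ g ≠ 0 ∧ S.LMr g = S.LMr f ∧ S.sig g = σ})
      ⟨S.sig f, f, hf, hf0, rfl, rfl⟩
    exact ⟨σ, hσ, fun g hg hg0 hgm => hmin _ ⟨g, hg, hg0, hgm, rfl⟩⟩
  rw [Omega, dif_pos hex]
  exact hex.choose_spec

end SignatureOrder

section WeylAlgebra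

variable (S : Setting n N K R)

/-- The normally ordered monomial `h^γ x^α ∂^β` of `R`. -/
def normalMon (d : Mon n) : R :=
  S.Xg none ^ d none *
    ((List.ofFn fun i : Fin n => S.Xg (some (Sum.inl i)) ^ d (some (Sum.inl i))).prod *
     (List.ofFn fun i : Fin n => S.Xg (some (Sum.inr i)) ^ d (some (Sum.inr i))).prod)

lemma Psi_normalMon (d : Mon n) : S.Psi (S.normalMon d) = monomial d 1 := S.Psi_monomial d

lemma Psi_one : S.Psi 1 = monomial 0 1 := by
  rw [← S.Psi_normalMon 0]
  simp [normalMon, List.ofFn_const]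

lemma Xg_none_mul_normalMon (d : Mon n) :
    S.Xg none * S.normalMon d = S.normalMon (d + Finsupp.single none 1) := by
  simp [normalMon, pow_succ', mul_assoc]

lemma exists_prod_pow_eq (g : Fin n → R) (e : Fin n → ℕ) (i : Fin n) :
    ∃ A B : R, (∀ z, (∀ j, j ≠ i → Commute z (g j)) → Commute z A ∧ Commute z B) ∧
      ∀ e' : Fin n → ℕ, (∀ j, j ≠ i → e' j = e j) →
        (List.ofFn fun j => g j ^ e' j).prod = A * g i ^ e' i * B := by
  obtain ⟨A, B, hc, h⟩ := exists_prod_ofFn_update_eq (fun j => g j ^ e j) i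
  refine ⟨A, B, fun z hz => hc z fun j hj => (hz j hj).pow_right _, fun e' he' => ?_⟩
  rw [← h]
  congr 2
  ext j
  by_cases hj : j = i
  · subst hj; simp
  · simp [hj, he' j hj]

lemma Xg_inl_mul_normalMon (i : Fin n) (d : Mon n) :
    S.Xg (some (Sum.inl i)) * S.normalMon d =
      S.normalMon (d + Finsupp.single (some (Sum.inl i)) 1) := by
  obtain ⟨A, B, hc, h⟩ := exists_prod_pow_eq (fun j => S.Xg (some (Sum.inl j)))
    (fun j => d (some (Sum.inl j))) i
  have hA := (hc (S.Xg (some (Sum.inl i))) fun j _ => S.x_comm i j).1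
  have hh : Commute (S.Xg (some (Sum.inl i))) (S.Xg none ^ d none) :=
    Commute.pow_right (S.h_comm _).symm _
  have h' := h (fun j => (d + Finsupp.single (some (Sum.inl i)) 1 : Mon n) (some (Sum.inl j)))
    fun j hj => by simp [Ne.symm hj]
  have h0 := h (fun j => d (some (Sum.inl j))) fun _ _ => rfl
  simp only [normalMon, h', h0]
  simp only [Finsupp.add_apply, Finsupp.single_apply, Option.some.injEq, reduceCtorEq, if_false,
    if_true, add_zero, pow_succ']
  simp only [← mul_assoc]
  rw [hh.eq]
  simp only [mul_assoc]
  rw [← mul_assoc (S.Xg (some (Sum.inl i))) A, hA.eq, mul_assoc]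

lemma Xg_inr_mul_pow (i : Fin n) (k : ℕ) :
    S.Xg (some (Sum.inr i)) * S.Xg (some (Sum.inl i)) ^ k =
      S.Xg (some (Sum.inl i)) ^ k * S.Xg (some (Sum.inr i)) +
        (k : R) * (S.Xg none ^ 2 * S.Xg (some (Sum.inl i)) ^ (k - 1)) := by
  induction k with
  | zero => simp
  | succ k ih =>
    have hh : Commute (S.Xg (some (Sum.inl i)) ^ k) (S.Xg none ^ 2) :=
      Commute.pow_pow (S.h_comm _).symm _ _
    have hk : (k : R) * (S.Xg none ^ 2 * S.Xg (some (Sum.inl i)) ^ (k - 1)) *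
        S.Xg (some (Sum.inl i)) =
        (k : R) * (S.Xg none ^ 2 * S.Xg (some (Sum.inl i)) ^ k) := by
      rcases k with _ | k
      · simp
      · simp [pow_succ, mul_assoc]
    rw [pow_succ, ← mul_assoc, ih, add_mul, hk, mul_assoc, S.dx_h, mul_add, hh.eq]
    push_cast
    noncomm_ring

lemma Xg_inr_mul_normalMon (i : Fin n) (d : Mon n) :
    S.Xg (some (Sum.inr i)) * S.normalMon d =
      S.normalMon (d + Finsupp.single (some (Sum.inr i)) 1) +
        (d (some (Sum.inl i)) : K) •
          S.normalMon (d - Finsupp.single (some (Sum.inl i)) 1 + Finsupp.single none 2) := by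
  obtain ⟨A, B, hc, h⟩ := exists_prod_pow_eq (fun j => S.Xg (some (Sum.inl j)))
    (fun j => d (some (Sum.inl j))) i
  obtain ⟨A', B', hc', h'⟩ := exists_prod_pow_eq (fun j => S.Xg (some (Sum.inr j)))
    (fun j => d (some (Sum.inr j))) i
  obtain ⟨hA, hB⟩ := hc (S.Xg (some (Sum.inr i))) fun j hj => S.dx_comm i j hj.symm
  have hhA := (hc (S.Xg none ^ 2) fun j _ => Commute.pow_left (S.h_comm _) _).1
  have hA' := (hc' (S.Xg (some (Sum.inr i))) fun j _ => S.d_comm i j).1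
  have hh : Commute (S.Xg (some (Sum.inr i))) (S.Xg none ^ d none) :=
    Commute.pow_right (S.h_comm _).symm _
  have hx₀ := h (fun j => d (some (Sum.inl j))) fun _ _ => rfl
  have hx₁ := h (fun j => (d + Finsupp.single (some (Sum.inr i)) 1 : Mon n) (some (Sum.inl j)))
    fun j _ => by simp
  have hx₂ := h (fun j => (d - Finsupp.single (some (Sum.inl i)) 1 + Finsupp.single none 2 : Mon n)
    (some (Sum.inl j))) fun j hj => by simp [Ne.symm hj]
  have hd₀ := h' (fun j => d (some (Sum.inr j))) fun _ _ => rfl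
  have hd₁ := h' (fun j => (d + Finsupp.single (some (Sum.inr i)) 1 : Mon n) (some (Sum.inr j)))
    fun j hj => by simp [Ne.symm hj]
  have hd₂ := h' (fun j => (d - Finsupp.single (some (Sum.inl i)) 1 + Finsupp.single none 2 : Mon n)
    (some (Sum.inr j))) fun j _ => by simp
  rw [Nat.cast_smul_eq_nsmul, nsmul_eq_mul]
  simp only [normalMon, hx₀, hx₁, hx₂, hd₀, hd₁, hd₂]
  simp only [Finsupp.add_apply, Finsupp.tsub_apply, Finsupp.single_apply, Option.some.injEq,
    reduceCtorEq, if_false, if_true, add_zero, Nat.sub_zero]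
  set p := S.Xg (some (Sum.inr i))
  set x := S.Xg (some (Sum.inl i))
  set t := S.Xg none ^ d none with ht
  set P := A' * p ^ d (some (Sum.inr i)) * B' with hP
  set k := d (some (Sum.inl i))
  have hpP : p * P = A' * p ^ (d (some (Sum.inr i)) + 1) * B' := by
    rw [hP, pow_succ', ← mul_assoc, ← mul_assoc, hA'.eq]
    simp only [mul_assoc]
  have hpx : p * (A * x ^ k * B) =
      A * x ^ k * B * p + (k : R) * (S.Xg none ^ 2 * (A * x ^ (k - 1) * B)) := by
    calc p * (A * x ^ k * B) = A * (p * x ^ k) * B := by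
          rw [← mul_assoc, ← mul_assoc, hA.eq, mul_assoc A]
      _ = A * x ^ k * (p * B) + A * ((k : R) * (S.Xg none ^ 2 * x ^ (k - 1))) * B := by
          rw [S.Xg_inr_mul_pow]; noncomm_ring
      _ = _ := by
          rw [hB.eq, ← mul_assoc A (k : R), ← (Nat.cast_commute k A).eq, mul_assoc (k : R),
            ← mul_assoc A, ← hhA.eq]
          simp only [mul_assoc]
  calc p * (t * (A * x ^ k * B * P)) = t * (p * (A * x ^ k * B) * P) := by
        rw [← mul_assoc, hh.eq]; simp only [mul_assoc]
    _ = t * (A * x ^ k * B * (p * P)) +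
          t * ((k : R) * (S.Xg none ^ 2 * (A * x ^ (k - 1) * B)) * P) := by
        rw [hpx]; noncomm_ring
    _ = _ := by
        rw [hpP, pow_add (S.Xg none), ← ht, mul_assoc (k : R), ← mul_assoc t (k : R),
          ← (Nat.cast_commute k t).eq]
        simp only [mul_assoc]

lemma Psi_mul_eq_of_normalMon (a : R) (L : Poly n K →ₗ[K] Poly n K)
    (h : ∀ d, S.Psi (a * S.normalMon d) = L (monomial d 1)) (r : R) :
    S.Psi (a * r) = L (S.Psi r) := by
  have key : S.Psi.toLinearMap ∘ₗ LinearMap.mulLeft K a ∘ₗ S.Psi.symm.toLinearMap = L := by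
    refine MvPolynomial.linearMap_ext fun d => LinearMap.ext_ring ?_
    simpa [← S.Psi_normalMon] using h d
  simp [← key]

lemma Psi_Xg_none_mul (r : R) : S.Psi (S.Xg none * r) = X none * S.Psi r := by
  refine S.Psi_mul_eq_of_normalMon _ (LinearMap.mulLeft K (X none)) (fun d => ?_) r
  rw [Xg_none_mul_normalMon, Psi_normalMon]
  simp [X, monomial_mul, add_comm]

lemma Psi_Xg_inl_mul (i : Fin n) (r : R) :
    S.Psi (S.Xg (some (Sum.inl i)) * r) = X (some (Sum.inl i)) * S.Psi r := by
  refine S.Psi_mul_eq_of_normalMon _ (LinearMap.mulLeft K (X (some (Sum.inl i)))) (fun d => ?_) r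
  rw [Xg_inl_mul_normalMon, Psi_normalMon]
  simp [X, monomial_mul, add_comm]

lemma Psi_Xg_inr_mul (i : Fin n) (r : R) :
    S.Psi (S.Xg (some (Sum.inr i)) * r) =
      X (some (Sum.inr i)) * S.Psi r + X none ^ 2 * pderiv (some (Sum.inl i)) (S.Psi r) := by
  refine S.Psi_mul_eq_of_normalMon _ (LinearMap.mulLeft K (X (some (Sum.inr i))) +
    LinearMap.mulLeft K (X none ^ 2) ∘ₗ (pderiv (some (Sum.inl i))).toLinearMap) (fun d => ?_) r
  rw [Xg_inr_mul_normalMon, map_add, map_smul, Psi_normalMon, Psi_normalMon]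
  simp [X, monomial_mul, monomial_pow, add_comm, pderiv_monomial, smul_monomial]

lemma eq_zero_of_Xg_mul_eq_zero (v : Vars n) {r : R} (h : S.Xg v * r = 0) : r = 0 := by
  rw [← S.Psi.map_eq_zero_iff] at h ⊢
  rcases v with _ | i | i
  · rw [Psi_Xg_none_mul] at h
    exact (mul_eq_zero.1 h).resolve_left (X_ne_zero _)
  · rw [Psi_Xg_inl_mul] at h
    exact (mul_eq_zero.1 h).resolve_left (X_ne_zero _)
  · rw [Psi_Xg_inr_mul] at h
    by_contra hr
    set p := S.Psi r
    have h₁ : degreeOf (some (Sum.inr i)) (p * X (some (Sum.inr i))) =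
        degreeOf (some (Sum.inr i)) p + 1 :=
      (degreeOf_mul_X_eq_degreeOf_add_one_iff _ _).2 hr
    have h₂ : p * X (some (Sum.inr i)) = pderiv (some (Sum.inl i)) p * (-X none ^ 2) := by
      linear_combination h
    have h₃ : degreeOf (some (Sum.inr i)) (-X none ^ 2 : Poly n K) = 0 := by
      rw [degreeOf_neg]
      exact degreeOf_X_pow_of_ne 2 (by simp)
    have h₄ := degreeOf_mul_le (some (Sum.inr i)) (pderiv (some (Sum.inl i)) p) (-X none ^ 2)
    have h₅ := degreeOf_pderiv_le (some (Sum.inl i)) (some (Sum.inr i)) p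
    rw [← h₂, h₁, h₃] at h₄
    omega

lemma normalMon_mem_nonZeroDivisorsLeft (d : Mon n) :
    S.normalMon d ∈ nonZeroDivisorsLeft R := by
  have hX : ∀ v, S.Xg v ∈ nonZeroDivisorsLeft R := fun v _ => S.eq_zero_of_Xg_mul_eq_zero v
  refine mul_mem (pow_mem (hX _) _) (mul_mem ?_ ?_) <;>
  · refine Submonoid.list_prod_mem _ fun a ha => ?_
    obtain ⟨j, rfl⟩ := (List.mem_ofFn' _ _).1 ha
    exact pow_mem (hX _) _

lemma IsTermR.mul_ne_zero {t g : R} (ht : S.IsTermR t) (hg : g ≠ 0) : t * g ≠ 0 := by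
  obtain ⟨d, c, hc, htd⟩ := ht
  have htc : t = c • S.normalMon d := S.Psi.injective (by
    rw [htd, map_smul, Psi_normalMon, smul_monomial, smul_eq_mul, mul_one])
  intro h0
  rw [htc, smul_mul_assoc, ← smul_zero c] at h0
  exact hg (S.normalMon_mem_nonZeroDivisorsLeft d g (smul_right_injective R hc h0))

lemma isTermR_one : S.IsTermR 1 := ⟨0, 1, one_ne_zero, S.Psi_one⟩

end WeylAlgebra

end Setting

end TropF5

open TropF5 MvPolynomial

variable {n N : ℕ} [NeZero N] {K R : Type*} [Field K] [Ring R] [Algebra K R]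

/-- Corollary `irriffomega`. A nonzero `f ∈ I` is `s`-top-irreducible
with respect to `s(f)` iff `s(f) = Ω(LM_h(f))`. -/
theorem stmt10 (S : Setting n N K R) (f : R) (hf : f ∈ S.idl) (hf0 : f ≠ 0) :
    S.sTopIrr f (S.sig f) ↔ S.sig f = S.Omega (S.LMr f) := by
  have hΩ := S.isOmega_Omega hf hf0
  constructor
  · intro hirr
    by_contra hne
    obtain ⟨g, hg, hg0, hgm, hgs⟩ := hΩ.1
    refine hirr.resolve_left hf0 ⟨g, hg, hg0, 1, S.isTermR_one, by rw [one_mul, hgm], ?_⟩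
    rw [one_mul, hgs]
    exact (S.ltSign_of_ne hne).resolve_left (hΩ.2 f hf hf0 rfl)
  · rintro heq
    refine Or.inr ?_
    rintro ⟨g, hg, hg0, t, ht, hm, hlt⟩
    exact hΩ.2 (t * g) (S.idl.smul_mem t hg) (Setting.IsTermR.mul_ne_zero S ht hg0) hm
      (heq ▸ hlt)


end
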